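/- Let (g, J, g) be a 2n-dimensional Hermitian Lie algebra with orthonormal basis e₁,…,e₂ₙ. Then the Lee form θ (the unique 1-form with dω^{n-1} = θ ∧ ω^{n-1}, ω = g(J·,·)) satisfies θ(X) = -tr(ad_X) + (1/2)·g(Σₗ [eₗ, J eₗ], J X) for all X ∈ g. -/

import Mathlib

open scoped RealInnerProductSpace

/-- Left-invariant `k`-forms (not assumed alternating) as plain functions. -/
abbrev Form11 (V : Type*) (k : ℕ) := (Fin k → V) → ℝ

/-- Wedge of a 1-form with a `k`-form. -/
def wedge1 {V : Type*} {k : ℕ} (θ : V → ℝ) (σ : Form11 V k) : Form11 V (k+1) :=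
  fun v => ∑ i : Fin (k+1), (-1 : ℝ)^(i : ℕ) * θ (v i) * σ (Fin.removeNth i v)

/-- Wedge of a 2-form with a `k`-form. -/
def wedge2 {V : Type*} {k : ℕ} (ω : V → V → ℝ) (σ : Form11 V k) : Form11 V (k+2) :=
  fun v => ∑ i : Fin (k+2), ∑ j : Fin (k+2),
    if h : (i : ℕ) < (j : ℕ) then
      (-1 : ℝ)^((i : ℕ) + (j : ℕ) + 1) * ω (v i) (v j) *
        σ (Fin.removeNth ⟨(i : ℕ), by have := j.isLt; omega⟩ (Fin.removeNth j v))
    else 0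

/-- `m`-th wedge power of a 2-form. -/
def ωpow {V : Type*} (ω : V → V → ℝ) : (m : ℕ) → Form11 V (2*m)
  | 0 => fun _ => 1
  | (m+1) => wedge2 ω (ωpow ω m)

/-- Chevalley–Eilenberg differential of a `(k+1)`-form on a Lie algebra with bracket `br`. -/
def dF {V : Type*} (br : V → V → V) {k : ℕ} (σ : Form11 V (k+1)) : Form11 V (k+2) :=
  fun v => ∑ i : Fin (k+2), ∑ j : Fin (k+2),
    if h : (i : ℕ) < (j : ℕ) then
      (-1 : ℝ)^((i : ℕ) + (j : ℕ)) *
        σ (Fin.cons (br (v i) (v j))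
            (Fin.removeNth ⟨(i : ℕ), by have := j.isLt; omega⟩ (Fin.removeNth j v)))
    else 0

section forms
variable {V : Type*}

/-- Contraction of a form with a vector. -/
def ctr {k : ℕ} (y : V) (σ : Form11 V (k+1)) : Form11 V k := fun v => σ (Fin.cons y v)

lemma form_ext {k : ℕ} {σ τ : Form11 V (k+1)}
    (h : ∀ y v, σ (Fin.cons y v) = τ (Fin.cons y v)) : σ = τ := by
  funext v
  rw [← Fin.cons_self_tail v]
  exact h _ _

lemma rem_zero {k : ℕ} (y : V) (v : Fin k → V) :
    Fin.removeNth (α := fun _ => V) (0 : Fin (k+1)) (Fin.cons y v) = v := by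
  funext i
  simp [Fin.removeNth]

lemma rem_succ {k : ℕ} (y : V) (v : Fin (k+1) → V) (i : Fin (k+1)) :
    Fin.removeNth (α := fun _ => V) i.succ (Fin.cons y v)
      = Fin.cons y (Fin.removeNth (α := fun _ => V) i v) := by
  funext j
  refine Fin.cases ?_ (fun j => ?_) j
  · simp [Fin.removeNth]
  · simp [Fin.removeNth]

lemma wedge1_cons {k : ℕ} (α : V → ℝ) (σ : Form11 V (k+1)) (y : V) (v : Fin (k+1) → V) :
    wedge1 α σ (Fin.cons y v) = α y * σ v - wedge1 α (ctr y σ) v := by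
  unfold wedge1
  rw [Fin.sum_univ_succ]
  simp only [Fin.cons_zero, Fin.cons_succ, rem_zero, rem_succ, Fin.val_zero, Fin.val_succ, ctr,
    pow_succ, pow_zero]
  rw [sub_eq_add_neg, ← Finset.sum_neg_distrib]
  congr 1
  · ring
  · exact Finset.sum_congr rfl fun i _ => by ring

lemma wedge1_cons0 (α : V → ℝ) (σ : Form11 V 0) (y : V) (v : Fin 0 → V) :
    wedge1 α σ (Fin.cons y v) = α y * σ v := by
  unfold wedge1
  rw [Fin.sum_univ_succ]
  simp [rem_zero]

lemma rem2_zero {k : ℕ} (y : V) (v : Fin (k+1) → V) (j : Fin (k+1)) (h) :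
    Fin.removeNth (α := fun _ => V) (⟨0, h⟩ : Fin (k+1))
      (Fin.removeNth (α := fun _ => V) j.succ (Fin.cons y v)) = Fin.removeNth j v := by
  rw [rem_succ]
  exact rem_zero _ _

lemma rem2_succ {k : ℕ} (y : V) (v : Fin (k+2) → V) (i : ℕ) (j : Fin (k+2)) (h)
    (h' : i < k + 1) :
    Fin.removeNth (α := fun _ => V) (⟨i+1, h⟩ : Fin (k+2))
      (Fin.removeNth (α := fun _ => V) j.succ (Fin.cons y v))
      = Fin.cons y (Fin.removeNth (α := fun _ => V) (⟨i, h'⟩ : Fin (k+1))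
          (Fin.removeNth (α := fun _ => V) j v)) := by
  rw [rem_succ]
  exact rem_succ _ _ ⟨i, h'⟩

lemma wedge2_cons {k : ℕ} (ω : V → V → ℝ) (σ : Form11 V (k+1)) (y : V) (v : Fin (k+2) → V) :
    wedge2 ω σ (Fin.cons y v) = wedge1 (ω y) σ v + wedge2 ω (ctr y σ) v := by
  unfold wedge2 wedge1
  rw [Fin.sum_univ_succ]
  congr 1
  · rw [Fin.sum_univ_succ]
    simp only [Fin.val_zero, lt_irrefl, dite_false, zero_add]
    refine Finset.sum_congr rfl fun j _ => ?_
    rw [dif_pos (by simp)]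
    rw [rem2_zero]
    simp only [Fin.cons_zero, Fin.cons_succ, Fin.val_succ, pow_succ]
    ring
  · refine Finset.sum_congr rfl fun i _ => ?_
    rw [Fin.sum_univ_succ, dif_neg (by simp), zero_add]
    refine Finset.sum_congr rfl fun j _ => ?_
    by_cases h : (i : ℕ) < j
    · rw [dif_pos (by simpa using h), dif_pos h]
      have := rem2_succ y v i j (by have := j.isLt; omega) (by have := j.isLt; omega)
      simp only [Fin.cons_succ, Fin.val_succ, this, ctr, pow_succ]
      simp only [pow_add]
      ring
    · rw [dif_neg (by simpa using h), dif_neg h]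

lemma wedge2_cons0 (ω : V → V → ℝ) (σ : Form11 V 0) (y : V) (v : Fin 1 → V) :
    wedge2 ω σ (Fin.cons y v) = wedge1 (ω y) σ v := by
  unfold wedge2 wedge1
  rw [Fin.sum_univ_succ]
  simp only [Fin.sum_univ_succ (n := 1)]
  simp
  left
  congr 1

lemma ctr_wedge1 {k : ℕ} (α : V → ℝ) (σ : Form11 V (k+1)) (y : V) :
    ctr y (wedge1 α σ) = fun v => α y * σ v + (-1) * wedge1 α (ctr y σ) v := by
  funext v
  simp only [ctr, wedge1_cons]
  ring

lemma ctr_wedge10 (α : V → ℝ) (σ : Form11 V 0) (y : V) :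
    ctr y (wedge1 α σ) = fun v => α y * σ v := by
  funext v
  simp only [ctr, wedge1_cons0]

lemma ctr_wedge2 {k : ℕ} (ω : V → V → ℝ) (σ : Form11 V (k+1)) (y : V) :
    ctr y (wedge2 ω σ) = fun v => 1 * wedge1 (ω y) σ v + 1 * wedge2 ω (ctr y σ) v := by
  funext v
  simp only [ctr, wedge2_cons, one_mul]

lemma wedge1_lin {k : ℕ} (α : V → ℝ) (σ τ : Form11 V k) (a b : ℝ) (v) :
    wedge1 α (fun w => a * σ w + b * τ w) v = a * wedge1 α σ v + b * wedge1 α τ v := by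
  unfold wedge1
  rw [Finset.mul_sum, Finset.mul_sum, ← Finset.sum_add_distrib]
  exact Finset.sum_congr rfl fun i _ => by ring

lemma wedge1_smul {k : ℕ} (α : V → ℝ) (σ : Form11 V k) (a : ℝ) (v) :
    wedge1 α (fun w => a * σ w) v = a * wedge1 α σ v := by
  unfold wedge1
  rw [Finset.mul_sum]
  exact Finset.sum_congr rfl fun i _ => by ring

lemma wedge2_lin {k : ℕ} (ω : V → V → ℝ) (σ τ : Form11 V k) (a b : ℝ) (v) :
    wedge2 ω (fun w => a * σ w + b * τ w) v = a * wedge2 ω σ v + b * wedge2 ω τ v := by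
  unfold wedge2
  simp only [Finset.mul_sum]
  simp only [← Finset.sum_add_distrib]
  refine Finset.sum_congr rfl fun i _ => Finset.sum_congr rfl fun j _ => ?_
  split_ifs
  · ring
  · ring

lemma wedge2_smul {k : ℕ} (ω : V → V → ℝ) (σ : Form11 V k) (a : ℝ) (v) :
    wedge2 ω (fun w => a * σ w) v = a * wedge2 ω σ v := by
  have := wedge2_lin ω σ σ a 0 v
  simpa using this

lemma wedge11 {k : ℕ} (α β : V → ℝ) (σ : Form11 V k) :
    wedge1 α (wedge1 β σ) = fun v => (-1) * wedge1 β (wedge1 α σ) v := by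
  induction k with
  | zero =>
    refine form_ext fun y v => ?_
    rw [wedge1_cons, wedge1_cons, ctr_wedge10, ctr_wedge10, wedge1_smul, wedge1_smul]
    ring
  | succ k ih =>
    refine form_ext fun y v => ?_
    rw [wedge1_cons, wedge1_cons, ctr_wedge1, ctr_wedge1, wedge1_lin, wedge1_lin, ih (ctr y σ)]
    ring

lemma wedge21 {k : ℕ} (ω : V → V → ℝ) (α : V → ℝ) (σ : Form11 V k) :
    wedge2 ω (wedge1 α σ) = wedge1 α (wedge2 ω σ) := by
  induction k with
  | zero =>
    refine form_ext fun y v => ?_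
    rw [wedge2_cons, wedge1_cons, ctr_wedge10, wedge2_smul, wedge11]
    have : ctr y (wedge2 ω σ) = wedge1 (ω y) σ := by
      funext v; exact wedge2_cons0 _ _ _ _
    rw [this]
    ring
  | succ k ih =>
    refine form_ext fun y v => ?_
    rw [wedge2_cons, wedge1_cons, ctr_wedge1, wedge2_lin, ctr_wedge2, wedge1_lin, ih, wedge11]
    ring

/-- `Σ_j (-1)^j B(v_j,·) ∧ σ` evaluated on the remaining vectors. -/
def dbl {k : ℕ} (B : V → V → ℝ) (σ : Form11 V k) : Form11 V (k+2) :=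
  fun v => ∑ j : Fin (k+2), (-1 : ℝ)^(j : ℕ) * wedge1 (B (v j)) σ (Fin.removeNth j v)

lemma dbl_eq {k : ℕ} (B : V → V → ℝ) (σ : Form11 V k) :
    dbl B σ = wedge2 (fun x y => B x y - B y x) σ := by
  induction k with
  | zero =>
    refine form_ext fun y v => ?_
    rw [wedge2_cons0, dbl, Fin.sum_univ_succ]
    simp only [Fin.cons_zero, Fin.cons_succ, rem_zero, rem_succ, wedge1_cons0]
    simp [wedge1]
    ring
  | succ k ih =>
    refine form_ext fun y v => ?_
    rw [wedge2_cons, ← ih, dbl, Fin.sum_univ_succ]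
    simp only [Fin.cons_zero, Fin.cons_succ, rem_zero, rem_succ, wedge1_cons]
    rw [dbl]
    simp only [Fin.val_zero, Fin.val_succ, pow_succ, pow_zero, one_mul]
    have : wedge1 (fun z => B y z - B z y) σ v = wedge1 (B y) σ v
        - ∑ j : Fin (k+2), (-1 : ℝ)^(j : ℕ) * B (v j) y * σ (Fin.removeNth j v) := by
      unfold wedge1
      rw [← Finset.sum_sub_distrib]
      exact Finset.sum_congr rfl fun i _ => by ring
    rw [this, sub_add, sub_eq_add_neg, ← Finset.sum_sub_distrib, ← Finset.sum_neg_distrib]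
    congr 1
    exact Finset.sum_congr rfl fun i _ => by ring

lemma ωpow_cons0 (ω : V → V → ℝ) (x : V) (v : Fin 1 → V) :
    ωpow ω 1 (Fin.cons x v) = wedge1 (ω x) (ωpow ω 0) v :=
  wedge2_cons0 _ _ _ _

lemma ctr_ωpow (ω : V → V → ℝ) (M : ℕ) (x : V) :
    ctr (k := 2*M+1) x (ωpow ω (M+1)) = fun v => ((M : ℝ) + 1) * wedge1 (ω x) (ωpow ω M) v := by
  induction M with
  | zero =>
    funext v
    have := ωpow_cons0 ω x v
    simpa [ctr] using this
  | succ M ih =>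
    have h : ctr (k := 2*M+3) x (ωpow ω (M+1+1))
        = fun v => 1 * wedge1 (ω x) (ωpow ω (M+1)) v
          + 1 * wedge2 ω (ctr (k := 2*M+1) x (ωpow ω (M+1))) v :=
      ctr_wedge2 (k := 2*M+1) ω (ωpow ω (M+1)) x
    refine h.trans ?_
    funext v
    rw [ih, wedge2_smul, wedge21]
    have : wedge2 ω (ωpow ω M) = ωpow ω (M+1) := rfl
    rw [this]
    push_cast
    ring

lemma wedge1_zero {k : ℕ} (α : V → ℝ) (σ : Form11 V k) (v : Fin (k+1) → V)
    (h : ∀ i, α (v i) = 0) : wedge1 α σ v = 0 := by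
  unfold wedge1
  exact Finset.sum_eq_zero fun i _ => by rw [h]; ring

lemma wedge1_zero2 {k : ℕ} (α : V → ℝ) (σ : Form11 V k) (v : Fin (k+1) → V)
    (h : ∀ i, σ (Fin.removeNth i v) = 0) : wedge1 α σ v = 0 := by
  unfold wedge1
  exact Finset.sum_eq_zero fun i _ => by rw [h]; ring

/-- contraction with a vector orthogonal to all entries. -/
lemma wedge1_ωpow_cons (ω : V → V → ℝ) (α : V → ℝ) (M : ℕ) (x : V) (u : Fin (2*M) → V)
    (h : ∀ i, ω x (u i) = 0) :
    wedge1 α (ωpow ω M) (Fin.cons x u) = α x * ωpow ω M u := by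
  cases M with
  | zero => exact wedge1_cons0 _ _ _ _
  | succ M =>
    have := wedge1_cons (k := 2*M+1) α (ωpow ω (M+1)) x u
    refine this.trans ?_
    rw [wedge1_zero2 (k := 2*M+1) α _ u, sub_zero]
    intro i
    rw [ctr_ωpow]
    have h0 : wedge1 (ω x) (ωpow ω M) (Fin.removeNth (α := fun _ => V) i u) = 0 :=
      wedge1_zero _ _ _ fun j => h _
    exact mul_eq_zero_of_right _ h0

/-- Standard frame `f₀, J f₀, f₁, J f₁, …`. -/
def fr (J : V → V) : (M : ℕ) → (Fin M → V) → (Fin (2*M) → V)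
  | 0, _ => Fin.elim0
  | (M+1), f => Fin.cons (α := fun _ => V) (n := 2*M+1) (f 0)
      (Fin.cons (α := fun _ => V) (n := 2*M) (J (f 0)) (fr J M (Fin.tail f)))

lemma fr_mem (J : V → V) (P : V → Prop) (M : ℕ) (f : Fin M → V) (h : ∀ a, P (f a))
    (h' : ∀ a, P (J (f a))) (i : Fin (2*M)) : P (fr J M f i) := by
  induction M with
  | zero => exact i.elim0
  | succ M ih =>
    revert i
    change ∀ i : Fin (2*M+2), _
    intro i
    refine Fin.cases (h 0) (fun i => ?_) i
    refine Fin.cases (h' 0) (fun i => ?_) i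
    exact ih (Fin.tail f) (fun a => h _) (fun a => h' _) i

/-- unitary frame relations for a 2-form -/
structure Std (ω : V → V → ℝ) (J : V → V) {M : ℕ} (f : Fin M → V) : Prop where
  one : ∀ a, ω (f a) (J (f a)) = 1
  h1 : ∀ a b, a ≠ b → ω (f a) (f b) = 0
  h2 : ∀ a b, a ≠ b → ω (f a) (J (f b)) = 0
  h3 : ∀ a b, a ≠ b → ω (J (f a)) (f b) = 0
  h4 : ∀ a b, a ≠ b → ω (J (f a)) (J (f b)) = 0

lemma Std.tail {ω : V → V → ℝ} {J : V → V} {M : ℕ} {f : Fin (M+1) → V} (h : Std ω J f) :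
    Std ω J (Fin.tail f) :=
  ⟨fun a => h.one _, fun a b hab => h.h1 _ _ (by simpa using hab),
   fun a b hab => h.h2 _ _ (by simpa using hab), fun a b hab => h.h3 _ _ (by simpa using hab),
   fun a b hab => h.h4 _ _ (by simpa using hab)⟩

lemma Std.z1 {ω : V → V → ℝ} {J : V → V} {M : ℕ} {f : Fin (M+1) → V} (h : Std ω J f) (i) :
    ω (f 0) (fr J M (Fin.tail f) i) = 0 :=
  fr_mem J (fun z => ω (f 0) z = 0) M _ (fun a => h.h1 _ _ (Fin.succ_ne_zero a).symm)
    (fun a => h.h2 _ _ (Fin.succ_ne_zero a).symm) i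

lemma Std.z2 {ω : V → V → ℝ} {J : V → V} {M : ℕ} {f : Fin (M+1) → V} (h : Std ω J f) (i) :
    ω (J (f 0)) (fr J M (Fin.tail f) i) = 0 :=
  fr_mem J (fun z => ω (J (f 0)) z = 0) M _ (fun a => h.h3 _ _ (Fin.succ_ne_zero a).symm)
    (fun a => h.h4 _ _ (Fin.succ_ne_zero a).symm) i

lemma ωpow_fr {ω : V → V → ℝ} {J : V → V} {M : ℕ} {f : Fin M → V} (h : Std ω J f) :
    ωpow ω M (fr J M f) = (M.factorial : ℝ) := by
  induction M with
  | zero => simp [ωpow]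
  | succ M ih =>
    have h1 := congrFun (ctr_ωpow ω M (f 0))
      (Fin.cons (α := fun _ => V) (n := 2*M) (J (f 0)) (fr J M (Fin.tail f)))
    refine Eq.trans h1 ?_
    rw [wedge1_ωpow_cons _ _ _ _ _ h.z2, h.one, ih h.tail, Nat.factorial_succ]
    push_cast
    ring

lemma trace_fr {ω : V → V → ℝ} {J : V → V} (η : V → V → ℝ) {M : ℕ} {f : Fin (M+1) → V}
    (h : Std ω J f) :
    wedge2 η (ωpow ω M) (fr J (M+1) f) = (M.factorial : ℝ) * ∑ a, η (f a) (J (f a)) := by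
  induction M with
  | zero =>
    refine (wedge2_cons0 η (ωpow ω 0) (f 0) _).trans ?_
    refine (wedge1_cons0 _ (ωpow ω 0) _ _).trans ?_
    simp [ωpow]
  | succ M ih =>
    refine (wedge2_cons (k := 2*M+1) η (ωpow ω (M+1)) (f 0) _).trans ?_
    rw [ctr_ωpow, wedge2_smul, wedge21]
    have e1 := wedge1_ωpow_cons ω (η (f 0)) (M+1) (J (f 0)) _ h.z2
    have e2 := wedge1_cons (k := 2*M+1) (ω (f 0)) (wedge2 η (ωpow ω M)) (J (f 0))
      (fr J (M+1) (Fin.tail f))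
    rw [wedge1_zero (k := 2*M+1) _ _ _ h.z1, sub_zero, h.one, one_mul, ih h.tail] at e2
    rw [ωpow_fr h.tail] at e1
    refine (congrArg₂ (fun p q : ℝ => p + ((M : ℝ)+1) * q) e1 e2).trans ?_
    rw [Fin.sum_univ_succ (n := M+1), Nat.factorial_succ]
    push_cast
    simp only [Fin.tail]
    ring

lemma dF_cons {k : ℕ} (br : V → V → V) (σ : Form11 V (k+2)) (y : V) (v : Fin (k+2) → V) :
    dF br σ (Fin.cons y v) =
      (-1) * ∑ j : Fin (k+2), (-1 : ℝ)^(j : ℕ) *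
        σ (Fin.cons (br y (v j)) (Fin.removeNth j v))
      + ∑ i : Fin (k+2), ∑ j : Fin (k+2),
      if h : (i : ℕ) < (j : ℕ) then
      (-1 : ℝ)^((i : ℕ) + (j : ℕ)) *
        σ (Fin.cons (br (v i) (v j)) (Fin.cons y
            (Fin.removeNth ⟨(i : ℕ), by have := j.isLt; omega⟩ (Fin.removeNth j v))))
      else 0 := by
  unfold dF
  rw [Fin.sum_univ_succ]
  congr 1
  · rw [Fin.sum_univ_succ, Finset.mul_sum]
    simp only [Fin.val_zero, lt_irrefl, dite_false, zero_add]
    refine Finset.sum_congr rfl fun j _ => ?_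
    rw [dif_pos (by simp)]
    rw [rem2_zero]
    simp only [Fin.cons_zero, Fin.cons_succ, Fin.val_succ, pow_succ]
    ring
  · refine Finset.sum_congr rfl fun i _ => ?_
    rw [Fin.sum_univ_succ, dif_neg (by simp), zero_add]
    refine Finset.sum_congr rfl fun j _ => ?_
    by_cases h : (i : ℕ) < j
    · rw [dif_pos (by simpa using h), dif_pos h]
      have := rem2_succ y v i j (by have := j.isLt; omega) (by have := j.isLt; omega)
      simp only [Fin.cons_succ, Fin.val_succ, this, pow_succ]
      simp only [pow_add]
      ring
    · rw [dif_neg (by simpa using h), dif_neg h]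

lemma wedge2_add {k : ℕ} (ω η : V → V → ℝ) (σ : Form11 V k) (v) :
    wedge2 (fun x y => ω x y + η x y) σ v = wedge2 ω σ v + wedge2 η σ v := by
  unfold wedge2
  simp only [← Finset.sum_add_distrib]
  refine Finset.sum_congr rfl fun i _ => Finset.sum_congr rfl fun j _ => ?_
  split_ifs
  · ring
  · ring

lemma dF_ωpow (br : V → V → V) (ω : V → V → ℝ) (m : ℕ) (X : V) (u : Fin (2*m+2) → V)
    (hX : ∀ i, ω X (u i) = 0) :
    dF (k := 2*m+1) br (ωpow ω (m+1)) (Fin.cons X u) =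
      -((m : ℝ)+1) * wedge2 (fun x y => (ω (br X x) y - ω (br X y) x) + ω (br x y) X)
        (ωpow ω m) u := by
  refine (dF_cons (k := 2*m) br (ωpow ω (m+1)) X u).trans ?_
  have key : ∀ z w, ωpow ω (m+1) (Fin.cons (α := fun _ => V) (n := 2*m+1) z w)
      = ((m : ℝ)+1) * wedge1 (ω z) (ωpow ω m) w := fun z w => congrFun (ctr_ωpow ω m z) w
  rw [wedge2_add, ← dbl_eq (fun x y => ω (br X x) y), mul_add]
  congr 1
  · rw [dbl, Finset.mul_sum, Finset.mul_sum]
    refine Finset.sum_congr rfl fun j _ => ?_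
    rw [key]
    ring
  · unfold wedge2
    rw [Finset.mul_sum]
    refine Finset.sum_congr rfl fun i _ => ?_
    rw [Finset.mul_sum]
    refine Finset.sum_congr rfl fun j _ => ?_
    split_ifs
    · rw [key, wedge1_ωpow_cons]
      swap
      · exact fun i => hX _
      simp only [pow_succ]
      ring
    · ring

end forms

section frame
variable {V : Type*} [NormedAddCommGroup V] [InnerProductSpace ℝ V] [FiniteDimensional ℝ V]

lemma skewJ (J : V →ₗ[ℝ] V) (hJ2 : ∀ x, J (J x) = -x)
    (hJorth : ∀ x y : V, ⟪J x, J y⟫ = ⟪x, y⟫) (x y : V) : ⟪J x, y⟫ = - ⟪x, J y⟫ := by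
  rw [← hJorth (J x) y, hJ2, inner_neg_left]

lemma selfJ (J : V →ₗ[ℝ] V) (hJ2 : ∀ x, J (J x) = -x)
    (hJorth : ∀ x y : V, ⟪J x, J y⟫ = ⟪x, y⟫) (x : V) : ⟪x, J x⟫ = 0 := by
  have := skewJ J hJ2 hJorth x x
  rw [real_inner_comm] at this
  linarith

lemma exists_unit (S : Submodule ℝ V) (h : Module.finrank ℝ S < Module.finrank ℝ V) :
    ∃ y : V, ‖y‖ = 1 ∧ ∀ z ∈ S, ⟪z, y⟫ = 0 := by
  have hne : Sᗮ ≠ ⊥ := by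
    intro h0
    rw [Submodule.orthogonal_eq_bot_iff] at h0
    rw [h0, finrank_top] at h
    exact lt_irrefl _ h
  obtain ⟨y, hy, hy0⟩ := Submodule.exists_mem_ne_zero_of_ne_bot hne
  refine ⟨(‖y‖⁻¹ : ℝ) • y, ?_, fun z hz => ?_⟩
  · rw [norm_smul, norm_inv, norm_norm, inv_mul_cancel₀ (norm_ne_zero_iff.mpr hy0)]
  · rw [inner_smul_right, (Submodule.mem_orthogonal S y).1 hy z hz, mul_zero]

lemma exists_frame (J : V →ₗ[ℝ] V) (hJ2 : ∀ x, J (J x) = -x)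
    (hJorth : ∀ x y : V, ⟪J x, J y⟫ = ⟪x, y⟫) (X : V) (k : ℕ)
    (hk : 2 * (k+1) ≤ Module.finrank ℝ V) :
    ∃ f : Fin (k+1) → V, (∀ a b, ⟪f a, f b⟫ = if a = b then (1:ℝ) else 0) ∧
      (∀ a b, ⟪f a, J (f b)⟫ = (0:ℝ)) ∧ ∃ c : ℝ, X = c • f (Fin.last k) := by
  induction k with
  | zero =>
    have : ∃ y : V, ‖y‖ = 1 ∧ ∃ c : ℝ, X = c • y := by
      by_cases hX : X = 0
      · obtain ⟨y, hy, _⟩ := exists_unit (⊥ : Submodule ℝ V) (by rw [finrank_bot]; omega)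
        exact ⟨y, hy, 0, by simp [hX]⟩
      · refine ⟨(‖X‖⁻¹ : ℝ) • X, ?_, ‖X‖, ?_⟩
        · rw [norm_smul, norm_inv, norm_norm, inv_mul_cancel₀ (norm_ne_zero_iff.mpr hX)]
        · rw [smul_smul, mul_inv_cancel₀ (norm_ne_zero_iff.mpr hX), one_smul]
    obtain ⟨y, hy, c, hc⟩ := this
    refine ⟨fun _ => y, fun a b => ?_, fun a b => selfJ J hJ2 hJorth y, c, hc⟩
    rw [if_pos (by omega), real_inner_self_eq_norm_sq, hy]
    norm_num
  | succ k ih =>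
    obtain ⟨f, h1, h2, c, hc⟩ := ih (by omega)
    let g : Fin (k+1) ⊕ Fin (k+1) → V := Sum.elim f (fun a => J (f a))
    obtain ⟨y, hy, hyo⟩ := exists_unit (Submodule.span ℝ (Set.range g)) (by
      have := finrank_range_le_card (R := ℝ) g
      rw [Set.finrank] at this
      simp at this
      omega)
    have o1 : ∀ a, ⟪f a, y⟫ = (0:ℝ) := fun a =>
      hyo _ (Submodule.subset_span ⟨Sum.inl a, rfl⟩)
    have o2 : ∀ a, ⟪J (f a), y⟫ = (0:ℝ) := fun a =>
      hyo _ (Submodule.subset_span ⟨Sum.inr a, rfl⟩)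
    have o3 : ∀ a, ⟪f a, J y⟫ = (0:ℝ) := fun a => by
      have := skewJ J hJ2 hJorth (f a) y
      rw [o2] at this
      linarith
    refine ⟨Fin.cons y f, fun a b => ?_, fun a b => ?_, c, ?_⟩
    · refine Fin.cases ?_ (fun a => ?_) a <;> refine Fin.cases ?_ (fun b => ?_) b
      · simp [hy]
      · rw [if_neg (Fin.succ_ne_zero b).symm]
        simpa [real_inner_comm] using o1 b
      · rw [if_neg (Fin.succ_ne_zero a)]
        simpa using o1 a
      · simpa using h1 a b
    · refine Fin.cases ?_ (fun a => ?_) a <;> refine Fin.cases ?_ (fun b => ?_) b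
      · exact selfJ J hJ2 hJorth y
      · simp only [Fin.cons_zero, Fin.cons_succ]
        rw [real_inner_comm]; exact o2 b
      · exact o3 a
      · exact h2 a b
    · rw [hc, ← Fin.succ_last, Fin.cons_succ]

lemma sum_indep {ι κ : Type*} [Fintype ι] [Fintype κ] (e : OrthonormalBasis ι ℝ V)
    (b : OrthonormalBasis κ ℝ V) (br : V →ₗ[ℝ] V →ₗ[ℝ] V) (J : V →ₗ[ℝ] V) (Z : V) :
    ∑ l, ⟪br (e l) (J (e l)), Z⟫ = ∑ l, ⟪br (b l) (J (b l)), Z⟫ := by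
  let T : V →ₗ[ℝ] V :=
    { toFun := fun x => LinearMap.adjoint ((br x).comp J) Z
      map_add' := fun x y => by simp [LinearMap.add_comp]
      map_smul' := fun c x => by simp [LinearMap.smul_comp] }
  have h : ∀ x, ⟪br x (J x), Z⟫ = ⟪x, T x⟫ := fun x => by
    change _ = ⟪x, LinearMap.adjoint ((br x).comp J) Z⟫
    rw [LinearMap.adjoint_inner_right]; rfl
  simp only [h]
  rw [← LinearMap.trace_eq_sum_inner, ← LinearMap.trace_eq_sum_inner]

end frame

/-- The Lee form of a `2n`-dimensional Hermitian Lie algebra (characterized by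
`dω^{n-1} = θ ∧ ω^{n-1}`) satisfies
`θ(X) = -tr(ad X) + ½ g(Σₗ [eₗ, Jeₗ], JX)` for any orthonormal basis `e`. -/
theorem stmt_11 {V : Type*} [NormedAddCommGroup V] [InnerProductSpace ℝ V]
    [FiniteDimensional ℝ V]
    (m : ℕ) (hdim : Module.finrank ℝ V = 2*(m+2))
    (br : V →ₗ[ℝ] V →ₗ[ℝ] V)
    (hskew : ∀ x y, br x y = - br y x)
    (hjac : ∀ x y z, br (br x y) z + br (br y z) x + br (br z x) y = 0)
    (J : V →ₗ[ℝ] V) (hJ2 : ∀ x, J (J x) = -x)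
    (hJorth : ∀ x y : V, ⟪J x, J y⟫ = ⟪x, y⟫)
    (hInt : ∀ x y, br (J x) (J y) - J (br (J x) y) - J (br x (J y)) - br x y = 0)
    (e : OrthonormalBasis (Fin (2*(m+2))) ℝ V)
    (ω : V → V → ℝ) (hω : ∀ x y, ω x y = ⟪J x, y⟫)
    (θ : V → ℝ)
    (hθ : ∀ v : Fin (2*m+3) → V,
      dF (k := 2*m+1) (fun x y => br x y) (ωpow ω (m+1)) v
        = wedge1 θ (ωpow ω (m+1)) v) :
    ∀ X : V, θ X = -(LinearMap.trace ℝ V (br X))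
      + (1/2) * ⟪∑ l, br (e l) (J (e l)), J X⟫ := by
  intro X
  obtain ⟨f, h1, h2, c, hc⟩ := exists_frame J hJ2 hJorth X (m+1) (by omega)
  have sk := skewJ J hJ2 hJorth
  let g : Fin (m+2) ⊕ Fin (m+2) → V := Sum.elim f (fun a => J (f a))
  have hg : Orthonormal ℝ g := by
    rw [orthonormal_iff_ite]
    rintro (a | a) (b | b)
    · simpa [g] using h1 a b
    · simpa [g] using h2 a b
    · simpa [g, real_inner_comm] using h2 b a
    · simpa [g, hJorth] using h1 a b
  let b := (basisOfOrthonormalOfCardEqFinrank hg (by simp [hdim]; ring)).toOrthonormalBasis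
    (by rw [coe_basisOfOrthonormalOfCardEqFinrank]; exact hg)
  have hb : ∀ i, b i = g i := fun i => by simp [b]
  let f' : Fin (m+1) → V := fun a => f a.castSucc
  have hne : ∀ a b : Fin (m+1), a ≠ b → ⟪f' a, f' b⟫ = (0:ℝ) := fun a b hab => by
    rw [h1, if_neg (by simpa using hab)]
  have hstd : Std ω J f' := by
    refine ⟨fun a => ?_, fun a b hab => ?_, fun a b hab => ?_, fun a b hab => ?_,
      fun a b hab => ?_⟩
    · rw [hω, hJorth, h1, if_pos rfl]
    · rw [hω, sk, h2, neg_zero]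
    · rw [hω, hJorth, hne _ _ hab]
    · rw [hω, hJ2, inner_neg_left, hne _ _ hab, neg_zero]
    · rw [hω, hJorth, real_inner_comm]
      exact h2 _ _
  have hXu : ∀ i, ω X (fr J (m+1) f' i) = 0 := by
    refine fr_mem J (fun z => ω X z = 0) _ _ (fun a => ?_) (fun a => ?_)
    · rw [hω, hc, sk, inner_smul_left, h2]; simp
    · rw [hω, hJorth, hc, inner_smul_left, h1, if_neg (Fin.castSucc_lt_last a).ne']; simp
  have E := hθ (Fin.cons (α := fun _ => V) (n := 2*m+2) X (fr J (m+1) f'))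
  have E1 := dF_ωpow (fun x y => br x y) ω m X (fr J (m+1) f') hXu
  have E2 := wedge1_ωpow_cons ω θ (m+1) X (fr J (m+1) f') hXu
  rw [trace_fr _ hstd] at E1
  rw [ωpow_fr hstd] at E2
  have E3 := (E1.symm.trans E).trans E2
  rw [Nat.factorial_succ] at E3
  push_cast at E3
  have hpos : ((m:ℝ)+1) * (m.factorial : ℝ) ≠ 0 := by positivity
  have E4 : θ X = - ∑ a, ((ω (br X (f' a)) (J (f' a)) - ω (br X (J (f' a))) (f' a))
      + ω (br (f' a) (J (f' a))) X) := by
    apply mul_right_cancel₀ hpos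
    rw [← E3]
    ring
  have T1 : LinearMap.trace ℝ V (br X) = ∑ a, (⟪br X (f a), f a⟫ + ⟪br X (J (f a)), J (f a)⟫) := by
    rw [LinearMap.trace_eq_sum_inner _ b]
    simp only [hb, Fintype.sum_sum_type, g, Sum.elim_inl, Sum.elim_inr]
    rw [← Finset.sum_add_distrib]
    exact Finset.sum_congr rfl fun a _ => by
      rw [real_inner_comm, real_inner_comm (J (f a))]
  have T2 : ⟪∑ l, br (e l) (J (e l)), J X⟫ = 2 * ∑ a, ⟪br (f a) (J (f a)), J X⟫ := by
    rw [sum_inner, sum_indep e b]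
    simp only [hb, Fintype.sum_sum_type, g, Sum.elim_inl, Sum.elim_inr]
    rw [two_mul]
    congr 1
    refine Finset.sum_congr rfl fun a _ => ?_
    rw [hJ2, map_neg, hskew (J (f a)), neg_neg]
  rw [T1, T2, E4, Fin.sum_univ_castSucc (n := m+1), Fin.sum_univ_castSucc (n := m+1)]
  have hXX : br (f (Fin.last (m+1))) (f (Fin.last (m+1))) = 0 := by
    have := hskew (f (Fin.last (m+1))) (f (Fin.last (m+1)))
    have h2' : (2:ℝ) • br (f (Fin.last (m+1))) (f (Fin.last (m+1))) = 0 := by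
      rw [two_smul]
      nth_rewrite 1 [this]
      exact neg_add_cancel _
    exact (smul_eq_zero.mp h2').resolve_left two_ne_zero
  have L1 : ⟪br X (f (Fin.last (m+1))), f (Fin.last (m+1))⟫ = (0:ℝ) := by
    rw [hc, map_smul, LinearMap.smul_apply, hXX]; simp
  have L2 : ⟪br X (J (f (Fin.last (m+1)))), J (f (Fin.last (m+1)))⟫
      = ⟪br (f (Fin.last (m+1))) (J (f (Fin.last (m+1)))), J X⟫ := by
    rw [hc, map_smul, LinearMap.smul_apply, map_smul, inner_smul_left, inner_smul_right]; simp
  rw [L1, L2]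
  have S : ∑ a, ((ω (br X (f' a)) (J (f' a)) - ω (br X (J (f' a))) (f' a))
      + ω (br (f' a) (J (f' a))) X)
      = ∑ a, (⟪br X (f' a), f' a⟫ + ⟪br X (J (f' a)), J (f' a)⟫)
        - ∑ a, ⟪br (f' a) (J (f' a)), J X⟫ := by
    rw [← Finset.sum_sub_distrib]
    refine Finset.sum_congr rfl fun a _ => ?_
    rw [hω, hω, hω, hJorth, sk, sk _ X]
    ring
  rw [S]
  simp only [f']
  ring
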